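/- arXiv:1811.09016 — 3 statements merged into one kernel-verified Lean document; each statement's English description precedes it below -/
import Mathlib

section
/- (Theorem 2, selection consistency.) In the penalized LSA setting, assume: (A1) there is a random p×p matrix G, almost surely symmetric positive definite, such that Ĝ_T → G in probability; (A2) the family (r_T^{-1}(θ̃_T − θ*))_T is bounded in probability; the family (r_T^{-1} a_T)_T is bounded in probability; and r_T^{-(2−q)} b_T → ∞ in probability, i.e. P(r_T^{-(2−q)} b_T ≤ M) → 0 as T → ∞ for every M > 0. Then P(θ̂_{T,j} = 0 for all j with p0 < j ≤ p) → 1 as T → ∞. -/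
open MeasureTheory Filter Topology

noncomputable section

/-- The penalized LSA objective function
`Q(θ) = (θ - θ̃)' G (θ - θ̃) + ∑ⱼ κⱼ |θⱼ|^q`. -/
def Qobj {p : ℕ} (G : Matrix (Fin p) (Fin p) ℝ) (θtil : EuclideanSpace ℝ (Fin p))
    (κ : Fin p → ℝ) (q : ℝ) (θ : EuclideanSpace ℝ (Fin p)) : ℝ :=
  (∑ i, ∑ j, (θ i - θtil i) * G i j * (θ j - θtil j)) + ∑ j, κ j * |θ j| ^ q

/-- A family of random vectors is bounded in probability (tight). -/
def BoundedInProb {Ω : Type*} [MeasurableSpace Ω] (P : Measure Ω)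
    {E : Type*} [Norm E] (X : ℕ → Ω → E) : Prop :=
  ∀ ε : ℝ, 0 < ε → ∃ M : ℝ, 0 < M ∧ ∀ T, P {ω | M < ‖X T ω‖} ≤ ENNReal.ofReal ε

/-- `a_T = max_{1 ≤ j ≤ p0} κ_T^j`. -/
def amax {p : ℕ} (p0 : ℕ) (κ : Fin p → ℝ) : ℝ :=
  sSup (κ '' {j : Fin p | (j : ℕ) < p0})

/-- `b_T = min_{p0 < j ≤ p} κ_T^j`. -/
def bmin {p : ℕ} (p0 : ℕ) (κ : Fin p → ℝ) : ℝ :=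
  sInf (κ '' {j : Fin p | p0 ≤ (j : ℕ)})

/-- The bilinear form `vᵀ G w`. -/
def matrixForm {p : ℕ} (G : Matrix (Fin p) (Fin p) ℝ) (v w : EuclideanSpace ℝ (Fin p)) : ℝ :=
  ∑ i, ∑ j, v i * G i j * w j

section matrixForm

variable {p : ℕ} (G : Matrix (Fin p) (Fin p) ℝ)

lemma matrixForm_sub_sub (v w : EuclideanSpace ℝ (Fin p)) :
    matrixForm G (v - w) (v - w) =
      matrixForm G v v - matrixForm G v w - matrixForm G w v + matrixForm G w w := by
  simp only [matrixForm, ← Finset.sum_sub_distrib, ← Finset.sum_add_distrib, PiLp.sub_apply]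
  refine Finset.sum_congr rfl fun i _ => Finset.sum_congr rfl fun j _ => ?_
  ring

lemma matrixForm_smul_smul (t : ℝ) (v : EuclideanSpace ℝ (Fin p)) :
    matrixForm G (t • v) (t • v) = t ^ 2 * matrixForm G v v := by
  simp only [matrixForm, Finset.mul_sum, PiLp.smul_apply, smul_eq_mul]
  refine Finset.sum_congr rfl fun i _ => Finset.sum_congr rfl fun j _ => ?_
  ring

lemma matrixForm_sub_left (H : Matrix (Fin p) (Fin p) ℝ) (v w : EuclideanSpace ℝ (Fin p)) :
    matrixForm (G - H) v w = matrixForm G v w - matrixForm H v w := by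
  simp only [matrixForm, ← Finset.sum_sub_distrib, Matrix.sub_apply]
  refine Finset.sum_congr rfl fun i _ => Finset.sum_congr rfl fun j _ => ?_
  ring

lemma abs_matrixForm_le {L : ℝ} (hL : ∀ i j, |G i j| ≤ L) (v w : EuclideanSpace ℝ (Fin p)) :
    |matrixForm G v w| ≤ p ^ 2 * L * (‖v‖ * ‖w‖) := by
  calc |matrixForm G v w| ≤ ∑ i, ∑ j, |v i * G i j * w j| :=
        (Finset.abs_sum_le_sum_abs _ _).trans
          (Finset.sum_le_sum fun i _ => Finset.abs_sum_le_sum_abs _ _)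
    _ ≤ ∑ _i : Fin p, ∑ _j : Fin p, ‖v‖ * L * ‖w‖ := by
        refine Finset.sum_le_sum fun i _ => Finset.sum_le_sum fun j _ => ?_
        rw [abs_mul, abs_mul]
        have hv : |v i| ≤ ‖v‖ := PiLp.norm_apply_le v i
        have hw : |w j| ≤ ‖w‖ := PiLp.norm_apply_le w j
        have hLn : 0 ≤ L := (abs_nonneg _).trans (hL i j)
        gcongr
        exact hL i j
    _ = p ^ 2 * L * (‖v‖ * ‖w‖) := by
        simp only [Finset.sum_const, Finset.card_univ, Fintype.card_fin, nsmul_eq_mul]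
        ring

lemma matrixForm_coercive_of_posDef {G : Matrix (Fin p) (Fin p) ℝ} (hG : G.PosDef) :
    ∃ c : ℝ, 0 < c ∧ ∀ v, c * ‖v‖ ^ 2 ≤ matrixForm G v v := by
  have hcont : Continuous fun v : EuclideanSpace ℝ (Fin p) => matrixForm G v v := by
    unfold matrixForm
    fun_prop
  have hpos : ∀ v : EuclideanSpace ℝ (Fin p), v ≠ 0 → 0 < matrixForm G v v := by
    intro v hv
    have hv' : v.ofLp ≠ 0 := fun h => hv (by ext i; simpa using congrFun h i)
    have h := hG.dotProduct_mulVec_pos hv'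
    simpa [matrixForm, dotProduct, Matrix.mulVec, Finset.mul_sum, mul_assoc] using h
  obtain ⟨c, hc, hcs⟩ := (isCompact_sphere (0 : EuclideanSpace ℝ (Fin p)) 1).exists_forall_le'
    hcont.continuousOn (a := 0)
    (fun v hv => hpos v (ne_zero_of_mem_unit_sphere ⟨v, hv⟩))
  refine ⟨c, hc, fun v => ?_⟩
  rcases eq_or_ne v 0 with rfl | hv
  · simp [matrixForm]
  have hn : 0 < ‖v‖ := norm_pos_iff.2 hv
  have h := hcs (‖v‖⁻¹ • v) (by simp [norm_smul, hn.ne'])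
  rw [matrixForm_smul_smul, inv_pow, inv_mul_eq_div, le_div_iff₀ (by positivity)] at h
  exact h

/-- Boundedness and coercivity of the form attached to a matrix, with constant `n`. -/
def WellConditioned (n : ℕ) : Prop :=
  (∀ i j, |G i j| ≤ n) ∧ ∀ v, ‖v‖ ^ 2 ≤ n * matrixForm G v v

variable {G}

lemma WellConditioned.mono {m n : ℕ} (hmn : m ≤ n) (h : WellConditioned G m) :
    WellConditioned G n := by
  have hmn' : (m : ℝ) ≤ n := by exact_mod_cast hmn
  refine ⟨fun i j => (h.1 i j).trans hmn', fun v => ?_⟩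
  have hv := h.2 v
  rcases (Nat.cast_nonneg m : (0 : ℝ) ≤ m).eq_or_lt with hm | hm
  · have h0 : ‖v‖ ^ 2 ≤ 0 := by simpa [← hm] using hv
    have hv0 : v = 0 := by simpa using le_antisymm h0 (sq_nonneg _)
    simp [hv0, matrixForm]
  · have hQ : 0 ≤ matrixForm G v v :=
      nonneg_of_mul_nonneg_right ((sq_nonneg _).trans hv) hm
    exact hv.trans (by gcongr)

lemma exists_wellConditioned (hG : G.PosDef) : ∃ n, WellConditioned G n := by
  obtain ⟨c, hc, hcoer⟩ := matrixForm_coercive_of_posDef hG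
  obtain ⟨n, hn⟩ := exists_nat_ge (c⁻¹ + ∑ i, ∑ j, |G i j|)
  have hsum : 0 ≤ ∑ i, ∑ j, |G i j| := by positivity
  refine ⟨n, fun i j => ?_, fun v => ?_⟩
  · have h1 : |G i j| ≤ ∑ j, |G i j| :=
      Finset.single_le_sum (f := fun j => |G i j|) (fun _ _ => abs_nonneg _) (Finset.mem_univ j)
    have h2 : ∑ j, |G i j| ≤ ∑ i, ∑ j, |G i j| :=
      Finset.single_le_sum (f := fun i => ∑ j, |G i j|) (fun _ _ => by positivity)
        (Finset.mem_univ i)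
    have : 0 < c⁻¹ := by positivity
    linarith
  · have h := hcoer v
    have hQ : 0 ≤ matrixForm G v v := le_trans (by positivity) h
    calc ‖v‖ ^ 2 = c⁻¹ * (c * ‖v‖ ^ 2) := by field_simp
      _ ≤ c⁻¹ * matrixForm G v v := by gcongr
      _ ≤ n * matrixForm G v v := by gcongr; linarith

lemma WellConditioned.of_close {n : ℕ} (h : WellConditioned G n)
    {H : Matrix (Fin p) (Fin p) ℝ}
    (hclose : ∀ i j, |H i j - G i j| ≤ 1 / (2 * (n + 1) * (p + 1) ^ 2)) :
    WellConditioned H (2 * (n + 1)) := by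
  have hδ : 1 / (2 * ((n : ℝ) + 1) * (p + 1) ^ 2) ≤ 1 := by
    rw [div_le_one (by positivity)]
    have h1 : (0 : ℝ) ≤ n := n.cast_nonneg
    have h2 : (1 : ℝ) ≤ (p + 1) ^ 2 := one_le_pow₀ (by simp)
    nlinarith
  refine ⟨fun i j => ?_, fun v => ?_⟩
  · have h1 := h.1 i j
    have h2 := hclose i j
    have h3 := abs_sub_abs_le_abs_sub (H i j) (G i j)
    have h4 : (0 : ℝ) ≤ n := n.cast_nonneg
    push_cast
    linarith
  · have h1 := (h.mono n.le_succ).2 v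
    have h2 := abs_matrixForm_le (H - G) hclose v v
    rw [matrixForm_sub_left] at h2
    have h3 : (n + 1) * (p ^ 2 * (1 / (2 * ((n : ℝ) + 1) * (p + 1) ^ 2)) * (‖v‖ * ‖v‖))
        ≤ ‖v‖ ^ 2 / 2 := by
      have h5 : (p : ℝ) ^ 2 / (p + 1) ^ 2 ≤ 1 := by
        rw [div_le_one (by positivity)]
        gcongr
        simp
      calc _ = (p : ℝ) ^ 2 / (p + 1) ^ 2 * (‖v‖ ^ 2 / 2) := by field_simp
        _ ≤ 1 * (‖v‖ ^ 2 / 2) := by gcongr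
        _ = _ := one_mul _
    have h4 := mul_le_mul_of_nonneg_left (neg_le_of_abs_le h2)
      (by positivity : (0 : ℝ) ≤ (n : ℝ) + 1)
    push_cast at h1 ⊢
    nlinarith

end matrixForm

lemma rpow_sub_rpow_le_mul_abs_sub {q x y : ℝ} (hq0 : 0 < q) (hq1 : q ≤ 1) (hx : 0 < x)
    (hy : 0 ≤ y) : x ^ q - y ^ q ≤ x ^ (q - 1) * |x - y| := by
  have hxpos : 0 < x ^ (q - 1) := Real.rpow_pos_of_pos hx _
  rcases le_total x y with hxy | hxy
  · have := Real.rpow_le_rpow hx.le hxy hq0.le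
    have : 0 ≤ x ^ (q - 1) * |x - y| := by positivity
    linarith
  · rw [abs_of_nonneg (sub_nonneg.2 hxy)]
    have hxq : x ^ q = x ^ (q - 1) * x := by
      rw [← Real.rpow_add_one hx.ne']; ring_nf
    have hyq : x ^ (q - 1) * y ≤ y ^ q := by
      rcases hy.eq_or_lt with rfl | hy
      · simp [Real.zero_rpow hq0.ne']
      · have : y ^ q = y ^ (q - 1) * y := by
          rw [← Real.rpow_add_one hy.ne']; ring_nf
        rw [this]
        have := Real.rpow_le_rpow_of_nonpos hy hxy (by linarith : q - 1 ≤ 0)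
        gcongr
    linarith

lemma le_mul_of_sq_le {A B r x : ℝ} (hA : 0 ≤ A) (hB : 0 ≤ B) (hr : 0 < r)
    (h : x ^ 2 ≤ A * r ^ 2 + B * r * x) : x ≤ (A + B + 1) * r := by
  by_contra! hx
  have hr1 : r ≤ x := by nlinarith
  nlinarith [mul_lt_mul_of_pos_right hx (hr.trans_le hr1), mul_le_mul_of_nonneg_left hr1
    (mul_nonneg hA hr.le), mul_pos hr (hr.trans_le hr1)]

lemma Qobj_eq {p : ℕ} (G : Matrix (Fin p) (Fin p) ℝ) (θtil : EuclideanSpace ℝ (Fin p))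
    (κ : Fin p → ℝ) (q : ℝ) (θ : EuclideanSpace ℝ (Fin p)) :
    Qobj G θtil κ q θ = matrixForm G (θ - θtil) (θ - θtil) + ∑ j, κ j * |θ j| ^ q := rfl

lemma le_amax {p p0 : ℕ} (κ : Fin p → ℝ) {j : Fin p} (hj : (j : ℕ) < p0) : κ j ≤ amax p0 κ :=
  le_csSup (Set.toFinite _).bddAbove ⟨j, hj, rfl⟩

lemma bmin_le {p p0 : ℕ} (κ : Fin p → ℝ) {j : Fin p} (hj : p0 ≤ (j : ℕ)) : bmin p0 κ ≤ κ j :=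
  csInf_le (Set.toFinite _).bddBelow ⟨j, hj, rfl⟩

/-- The penalty gained by moving away from `θstar` is at most linear in the distance. -/
lemma penalty_sub_le {p p0 : ℕ} {q : ℝ} (hq0 : 0 < q) (hq1 : q ≤ 1)
    {θstar : EuclideanSpace ℝ (Fin p)} (hactive : ∀ j : Fin p, (j : ℕ) < p0 → θstar j ≠ 0)
    (hzero : ∀ j : Fin p, p0 ≤ (j : ℕ) → θstar j = 0) {κ : Fin p → ℝ} (hκ : ∀ j, 0 ≤ κ j)
    {A : ℝ} (hA0 : 0 ≤ A) (hA : amax p0 κ ≤ A) (θ : EuclideanSpace ℝ (Fin p)) :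
    ∑ j, κ j * |θstar j| ^ q - ∑ j, κ j * |θ j| ^ q ≤
      A * (∑ j, |θstar j| ^ (q - 1)) * ‖θ - θstar‖ := by
  rw [← Finset.sum_sub_distrib, Finset.mul_sum, Finset.sum_mul]
  refine Finset.sum_le_sum fun j _ => ?_
  rw [← mul_sub]
  rcases lt_or_ge (j : ℕ) p0 with hj | hj
  · have h1 := rpow_sub_rpow_le_mul_abs_sub hq0 hq1 (abs_pos.2 (hactive j hj))
      (abs_nonneg (θ j))
    have h2 : |(|θstar j| - |θ j|)| ≤ ‖θ - θstar‖ := by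
      refine (abs_abs_sub_abs_le _ _).trans ?_
      rw [abs_sub_comm]
      exact PiLp.norm_apply_le (θ - θstar) j
    have h3 : κ j ≤ A := (le_amax κ hj).trans hA
    calc κ j * (|θstar j| ^ q - |θ j| ^ q)
        ≤ κ j * (|θstar j| ^ (q - 1) * ‖θ - θstar‖) := by
          refine mul_le_mul_of_nonneg_left (h1.trans ?_) (hκ j)
          gcongr
      _ ≤ A * (|θstar j| ^ (q - 1) * ‖θ - θstar‖) := by gcongr
      _ = _ := by ring
  · rw [hzero j hj, abs_zero, Real.zero_rpow hq0.ne']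
    have h1 : 0 ≤ κ j * |θ j| ^ q := mul_nonneg (hκ j) (by positivity)
    have h2 : 0 ≤ A * (0 : ℝ) ^ (q - 1) * ‖θ - θstar‖ := by positivity
    linarith

/-- On an event where all ingredients are controlled, the minimizer of the penalized LSA objective
is within a constant multiple of `r` of the initial estimator. -/
lemma exists_norm_minimizer_sub_le {p p0 : ℕ} {q : ℝ} (hq0 : 0 < q) (hq1 : q ≤ 1)
    {θstar : EuclideanSpace ℝ (Fin p)} (hactive : ∀ j : Fin p, (j : ℕ) < p0 → θstar j ≠ 0)
    (hzero : ∀ j : Fin p, p0 ≤ (j : ℕ) → θstar j = 0) (n : ℕ) {M : ℝ} (hM : 0 ≤ M) :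
    ∃ K : ℝ, 0 ≤ K ∧ ∀ (r : ℝ) (G : Matrix (Fin p) (Fin p) ℝ)
      (θtil θhat : EuclideanSpace ℝ (Fin p)) (κ : Fin p → ℝ), 0 < r → WellConditioned G n →
      (∀ j, 0 ≤ κ j) → ‖θtil - θstar‖ ≤ M * r → amax p0 κ ≤ M * r →
      Qobj G θtil κ q θhat ≤ Qobj G θtil κ q θstar → ‖θhat - θtil‖ ≤ K * r := by
  set C : ℝ := ∑ j, |θstar j| ^ (q - 1) with hC
  have hC0 : 0 ≤ C := by positivity
  refine ⟨n * (p ^ 2 * n * M ^ 2 + M * C * M) + n * (M * C) + 1, by positivity, ?_⟩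
  intro r G θtil θhat κ hr hG hκ hθ ha hQ
  refine le_mul_of_sq_le (by positivity) (by positivity) hr ?_
  have hpen := penalty_sub_le hq0 hq1 hactive hzero hκ (by positivity) ha θhat
  rw [← hC] at hpen
  have htri : ‖θhat - θstar‖ ≤ ‖θhat - θtil‖ + M * r :=
    (norm_sub_le_norm_sub_add_norm_sub _ θtil _).trans (by gcongr)
  have hform := (le_abs_self _).trans
    (abs_matrixForm_le G hG.1 (θstar - θtil) (θstar - θtil))
  rw [norm_sub_rev θstar θtil] at hform
  rw [Qobj_eq, Qobj_eq] at hQ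
  have hform' : matrixForm G (θstar - θtil) (θstar - θtil) ≤ p ^ 2 * n * (M * r * (M * r)) :=
    hform.trans (by gcongr)
  have hpen' := hpen.trans (mul_le_mul_of_nonneg_left htri (by positivity))
  have hle : matrixForm G (θhat - θtil) (θhat - θtil) ≤
      p ^ 2 * n * (M * r * (M * r)) + M * r * C * (‖θhat - θtil‖ + M * r) := by linarith
  calc ‖θhat - θtil‖ ^ 2 ≤ n * matrixForm G (θhat - θtil) (θhat - θtil) := hG.2 _
    _ ≤ n * (p ^ 2 * n * (M * r * (M * r)) + M * r * C * (‖θhat - θtil‖ + M * r)) := by gcongr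
    _ = _ := by ring

/-- On an event where all ingredients are controlled, a nonzero inactive coordinate of the
minimizer forces `r ^ (-(2 - q)) * bmin p0 κ` to be bounded. -/
lemma exists_bmin_le_of_ne_zero {p p0 : ℕ} {q : ℝ} (hq0 : 0 < q) (hq1 : q ≤ 1)
    {θstar : EuclideanSpace ℝ (Fin p)} (hactive : ∀ j : Fin p, (j : ℕ) < p0 → θstar j ≠ 0)
    (hzero : ∀ j : Fin p, p0 ≤ (j : ℕ) → θstar j = 0) (n : ℕ) {M : ℝ} (hM : 0 ≤ M) :
    ∃ B : ℝ, 0 < B ∧ ∀ (r : ℝ) (G : Matrix (Fin p) (Fin p) ℝ)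
      (θtil θhat : EuclideanSpace ℝ (Fin p)) (κ : Fin p → ℝ), 0 < r → WellConditioned G n →
      (∀ j, 0 ≤ κ j) → ‖θtil - θstar‖ ≤ M * r → amax p0 κ ≤ M * r →
      (∀ θ, Qobj G θtil κ q θhat ≤ Qobj G θtil κ q θ) →
      ∀ j : Fin p, p0 ≤ (j : ℕ) → θhat j ≠ 0 → r ^ (-(2 - q)) * bmin p0 κ ≤ B := by
  obtain ⟨K, hK, hrate⟩ := exists_norm_minimizer_sub_le hq0 hq1 hactive hzero n hM
  set D : ℝ := p ^ 2 * n * (3 * K + M) with hD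
  refine ⟨D * (K + M) ^ (1 - q) + 1, by positivity, ?_⟩
  intro r G θtil θhat κ hr hG hκ hθ ha hmin j hj hne
  have hw := hrate r G θtil θhat κ hr hG hκ hθ ha (hmin θstar)
  set h : ℝ := θhat j with hh
  have hhpos : 0 < |h| := abs_pos.2 hne
  have hhle : |h| ≤ (K + M) * r := by
    have h1 : |h| ≤ ‖θhat - θstar‖ := by
      simpa [hzero j hj] using PiLp.norm_apply_le (θhat - θstar) j
    have h2 := norm_sub_le_norm_sub_add_norm_sub θhat θtil θstar
    linarith
  set z : EuclideanSpace ℝ (Fin p) := EuclideanSpace.single j h with hz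
  have hnz : ‖z‖ = |h| := by simp [hz]
  have hpen : ∑ i, κ i * |θhat i| ^ q - ∑ i, κ i * |(θhat - z) i| ^ q = κ j * |h| ^ q := by
    rw [← Finset.sum_sub_distrib, Finset.sum_eq_single j]
    · simp [hz, ← hh, Real.zero_rpow hq0.ne']
    · intro i _ hij
      simp [hz, hij]
    · simp
  have hcmp := hmin (θhat - z)
  rw [Qobj_eq, Qobj_eq, sub_right_comm θhat z θtil, matrixForm_sub_sub _ (θhat - θtil) z] at hcmp
  have h1 := neg_le_of_abs_le (abs_matrixForm_le G hG.1 (θhat - θtil) z)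
  have h2 := neg_le_of_abs_le (abs_matrixForm_le G hG.1 z (θhat - θtil))
  have h3 := le_of_abs_le (abs_matrixForm_le G hG.1 z z)
  rw [hnz] at h1 h2 h3
  have hκh : κ j * |h| ^ q ≤ D * r * |h| := by
    calc κ j * |h| ^ q
        ≤ p ^ 2 * n * (2 * (‖θhat - θtil‖ * |h|) + |h| * |h|) := by linarith
      _ ≤ p ^ 2 * n * (2 * (K * r * |h|) + (K + M) * r * |h|) := by gcongr
      _ = D * r * |h| := by rw [hD]; ring
  have hsplit : |h| = |h| ^ (1 - q) * |h| ^ q := by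
    rw [← Real.rpow_add hhpos]; simp
  have hκj : κ j ≤ D * r * |h| ^ (1 - q) := by
    refine le_of_mul_le_mul_right ?_ (Real.rpow_pos_of_pos hhpos q)
    rwa [mul_assoc _ (|h| ^ (1 - q)), ← hsplit]
  have hpow : |h| ^ (1 - q) ≤ (K + M) ^ (1 - q) * r ^ (1 - q) := by
    rw [← Real.mul_rpow (by positivity) hr.le]
    exact Real.rpow_le_rpow hhpos.le hhle (by linarith)
  have hr2 : r ^ (-(2 - q)) * (r * r ^ (1 - q)) = 1 := by
    rw [← Real.rpow_one_add' hr.le (by linarith), ← Real.rpow_add hr]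
    ring_nf
    simp
  calc r ^ (-(2 - q)) * bmin p0 κ
      ≤ r ^ (-(2 - q)) * (D * r * ((K + M) ^ (1 - q) * r ^ (1 - q))) := by
        gcongr
        exact (bmin_le κ hj).trans (hκj.trans (by gcongr))
    _ = D * (K + M) ^ (1 - q) * (r ^ (-(2 - q)) * (r * r ^ (1 - q))) := by ring
    _ ≤ _ := by rw [hr2]; linarith

/-- Outer measure is continuous along increasing sets, so no measurability of `G` is needed. -/
lemma tendsto_measure_wellConditioned {Ω : Type*} [MeasurableSpace Ω] (P : Measure Ω)
    [IsProbabilityMeasure P] {p : ℕ} {G : Ω → Matrix (Fin p) (Fin p) ℝ}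
    (hGpd : ∀ᵐ ω ∂P, (G ω).PosDef) :
    Tendsto (fun n => P {ω | WellConditioned (G ω) n}) atTop (𝓝 1) := by
  have hmono : Monotone fun n => {ω | WellConditioned (G ω) n} :=
    fun m n hmn ω hω => WellConditioned.mono hmn hω
  have h1 : P (⋃ n, {ω | WellConditioned (G ω) n}) = 1 := by
    rw [← measure_univ (μ := P)]
    refine measure_congr (eventuallyEq_univ.2 ?_)
    filter_upwards [hGpd] with ω hω
    simpa using exists_wellConditioned hω
  exact h1 ▸ tendsto_measure_iUnion_atTop hmono

/-- Theorem 2 (selection consistency of the penalized LSA estimator). -/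
theorem penalizedLSA_selection_consistency
    {Ω : Type*} [MeasurableSpace Ω] (P : Measure Ω) [IsProbabilityMeasure P]
    (p p0 : ℕ) (hp0 : 1 ≤ p0) (hp : p0 ≤ p)
    (q : ℝ) (hq0 : 0 < q) (hq1 : q ≤ 1)
    (θstar : EuclideanSpace ℝ (Fin p))
    (hactive : ∀ j : Fin p, (j : ℕ) < p0 → θstar j ≠ 0)
    (hzero : ∀ j : Fin p, p0 ≤ (j : ℕ) → θstar j = 0)
    (r : ℕ → ℝ) (hrpos : ∀ T, 0 < r T) (hr0 : Tendsto r atTop (𝓝 0))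
    (θtil : ℕ → Ω → EuclideanSpace ℝ (Fin p))
    (Ghat : ℕ → Ω → Matrix (Fin p) (Fin p) ℝ)
    (hGhatpd : ∀ T, ∀ᵐ ω ∂P, (Ghat T ω).PosDef)
    (κ : ℕ → Ω → Fin p → ℝ) (hκ : ∀ T ω j, 0 ≤ κ T ω j)
    (θhat : ℕ → Ω → EuclideanSpace ℝ (Fin p))
    (hmin : ∀ T, ∀ᵐ ω ∂P, ∀ θ : EuclideanSpace ℝ (Fin p),
      Qobj (Ghat T ω) (θtil T ω) (κ T ω) q (θhat T ω) ≤
        Qobj (Ghat T ω) (θtil T ω) (κ T ω) q θ)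
    -- (A1)
    (G : Ω → Matrix (Fin p) (Fin p) ℝ) (hGpd : ∀ᵐ ω ∂P, (G ω).PosDef)
    (hGconv : ∀ i j : Fin p,
      TendstoInMeasure P (fun T ω => Ghat T ω i j) atTop (fun ω => G ω i j))
    -- (A2)
    (hA2 : BoundedInProb P (fun T ω => (r T)⁻¹ • (θtil T ω - θstar)))
    -- `r_T⁻¹ a_T` is bounded in probability
    (ha : BoundedInProb P (fun T ω => (r T)⁻¹ * amax p0 (κ T ω)))
    -- `r_T^{-(2-q)} b_T → ∞` in probability
    (hb : ∀ M : ℝ, 0 < M →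
      Tendsto (fun T => P {ω | r T ^ (-(2 - q)) * bmin p0 (κ T ω) ≤ M}) atTop (𝓝 0)) :
    Tendsto (fun T => P {ω | ∀ j : Fin p, p0 ≤ (j : ℕ) → θhat T ω j = 0})
      atTop (𝓝 1) := by
  refine tendsto_order.2 ⟨fun a ha1 => ?_, fun a ha1 =>
    Eventually.of_forall fun T => prob_le_one.trans_lt ha1⟩
  obtain ⟨n, hn⟩ := ((tendsto_order.1 (tendsto_measure_wellConditioned P hGpd)).1 a ha1).exists
  set S := {ω | WellConditioned (G ω) n} with hS
  have hδ0 : P S - a ≠ 0 := (tsub_pos_of_lt hn).ne'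
  have hδtop : P S - a ≠ ⊤ := ENNReal.sub_ne_top (measure_ne_top P S)
  set ε : ℝ := ((P S - a) / 4).toReal with hε
  have hε4 : ENNReal.ofReal ε = (P S - a) / 4 :=
    ENNReal.ofReal_toReal (ENNReal.div_ne_top hδtop (by norm_num))
  have hε0 : 0 < ε :=
    ENNReal.toReal_pos (ENNReal.div_ne_zero.2 ⟨hδ0, by norm_num⟩)
      (ENNReal.div_ne_top hδtop (by norm_num))
  obtain ⟨M₁, hM₁, hθbad⟩ := hA2 ε hε0
  obtain ⟨M₂, hM₂, habad⟩ := ha ε hε0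
  obtain ⟨B, hB, hsel⟩ := exists_bmin_le_of_ne_zero hq0 hq1 hactive hzero (2 * (n + 1))
    (hM₁.le.trans (le_max_left M₁ M₂))
  set δ : ℝ := 1 / (2 * (n + 1) * (p + 1) ^ 2) with hδ
  have hδpos : 0 < δ := by positivity
  have hGbad : Tendsto (fun T => ∑ i, ∑ j, P {ω | δ ≤ ‖Ghat T ω i j - G ω i j‖}) atTop (𝓝 0) := by
    have : Tendsto (fun T => ∑ i, ∑ j, P {ω | δ ≤ ‖Ghat T ω i j - G ω i j‖}) atTop
        (𝓝 (∑ _i : Fin p, ∑ _j : Fin p, 0)) :=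
      tendsto_finsetSum _ fun i _ => tendsto_finsetSum _ fun j _ =>
        tendstoInMeasure_iff_norm.1 (hGconv i j) δ hδpos
    simpa using this
  have hbad : Tendsto (fun T => ENNReal.ofReal ε + ENNReal.ofReal ε +
      P {ω | r T ^ (-(2 - q)) * bmin p0 (κ T ω) ≤ B} +
      ∑ i, ∑ j, P {ω | δ ≤ ‖Ghat T ω i j - G ω i j‖}) atTop
      (𝓝 (ENNReal.ofReal ε + ENNReal.ofReal ε + 0 + 0)) :=
    (tendsto_const_nhds.add (hb B hB)).add hGbad
  have hlt : ENNReal.ofReal ε + ENNReal.ofReal ε + 0 + 0 < P S - a := by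
    have hfin : P S - a = ENNReal.ofReal (4 * ε) := by
      rw [ENNReal.ofReal_mul (by norm_num), hε4, ENNReal.ofReal_ofNat,
        ENNReal.mul_div_cancel (by norm_num) (by norm_num)]
    rw [hfin, add_zero, add_zero, ← ENNReal.ofReal_add hε0.le hε0.le]
    exact (ENNReal.ofReal_lt_ofReal_iff (by positivity)).2 (by linarith)
  filter_upwards [(tendsto_order.1 hbad).2 _ hlt] with T hT
  set E := {ω | ∀ j : Fin p, p0 ≤ (j : ℕ) → θhat T ω j = 0} with hE
  set N := {ω | ¬ ∀ θ : EuclideanSpace ℝ (Fin p),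
      Qobj (Ghat T ω) (θtil T ω) (κ T ω) q (θhat T ω) ≤
        Qobj (Ghat T ω) (θtil T ω) (κ T ω) q θ} with hN
  have hN0 : P N = 0 := ae_iff.1 (hmin T)
  set U₁ := {ω | M₁ < ‖(r T)⁻¹ • (θtil T ω - θstar)‖}
  set U₂ := {ω | M₂ < ‖(r T)⁻¹ * amax p0 (κ T ω)‖}
  set U₃ := {ω | r T ^ (-(2 - q)) * bmin p0 (κ T ω) ≤ B}
  set U₄ := ⋃ i, ⋃ j, {ω | δ ≤ ‖Ghat T ω i j - G ω i j‖}
  have hcover : S ⊆ E ∪ (U₁ ∪ U₂ ∪ U₃ ∪ U₄ ∪ N) := by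
    intro ω hω
    by_contra hcon
    simp only [Set.mem_union, not_or] at hcon
    obtain ⟨hωE, ⟨⟨⟨h1, h2⟩, h3⟩, h4⟩, h5⟩ := hcon
    simp only [hE, hN, U₁, U₂, U₃, U₄, Set.mem_ofPred_eq, Set.mem_iUnion, not_exists, not_lt,
      not_le, not_forall] at hωE h1 h2 h3 h4 h5
    obtain ⟨j, hj, hne⟩ := hωE
    have hr := hrpos T
    rw [norm_smul, norm_inv, Real.norm_of_nonneg hr.le, inv_mul_le_iff₀ hr] at h1
    have h2' := (Real.le_norm_self _).trans h2
    rw [inv_mul_le_iff₀ hr] at h2'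
    refine h3.not_ge (hsel (r T) (Ghat T ω) (θtil T ω) (θhat T ω) (κ T ω) hr
      (WellConditioned.of_close hω fun i j => (h4 i j).le) (hκ T ω) (h1.trans ?_) (h2'.trans ?_)
      h5 j hj hne)
    · rw [mul_comm]; gcongr; exact le_max_left _ _
    · rw [mul_comm]; gcongr; exact le_max_right _ _
  have hU₄ : P U₄ ≤ ∑ i, ∑ j, P {ω | δ ≤ ‖Ghat T ω i j - G ω i j‖} :=
    (measure_iUnion_fintype_le _ _).trans
      (Finset.sum_le_sum fun i _ => measure_iUnion_fintype_le _ _)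
  have hU : P (U₁ ∪ U₂ ∪ U₃ ∪ U₄ ∪ N) < P S - a := by
    refine lt_of_le_of_lt ?_ hT
    calc P (U₁ ∪ U₂ ∪ U₃ ∪ U₄ ∪ N) ≤ P U₁ + P U₂ + P U₃ + P U₄ + P N := by
          refine (measure_union_le _ _).trans ?_
          gcongr
          refine (measure_union_le _ _).trans ?_
          gcongr
          refine (measure_union_le _ _).trans ?_
          gcongr
          exact measure_union_le _ _
      _ ≤ _ := by
          rw [hN0, add_zero]
          gcongr
          · exact hθbad T
          · exact habad T
  by_contra! hle
  have h6 : P S ≤ a + P (U₁ ∪ U₂ ∪ U₃ ∪ U₄ ∪ N) :=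
    (measure_mono hcover).trans ((measure_union_le _ _).trans (by gcongr))
  exact (h6.trans_lt ((ENNReal.add_lt_add_iff_left ha1.ne_top).2 hU)).ne
    (add_tsub_cancel_of_le hn.le).symm
end
end

section
/- (Deterministic basic inequality for the penalized LSA objective, inequality (5.4).) Let p, p0 ∈ ℕ with 1 ≤ p0 ≤ p, let q ∈ (0,1], let G be a real symmetric positive definite p×p matrix, let θ̃ ∈ ℝ^p, let θ* ∈ ℝ^p with θ*_j ≠ 0 for 1 ≤ j ≤ p0 and θ*_j = 0 for p0 < j ≤ p, and let κ_1, …, κ_p ≥ 0. Define Q(θ) = (θ − θ̃)′ G (θ − θ̃) + Σ_{j=1}^p κ_j |θ_j|^q, K* = max_{1≤j≤p0} |θ*_j|^{q−1}, and a = max_{1≤j≤p0} κ_j. Then every θ̂ ∈ ℝ^p with Q(θ̂) ≤ Q(θ*) satisfies |θ̂ − θ*| ≤ ‖G^{−1}‖ ( 2 ‖G‖ |θ̃ − θ*| + p0 K* a ), where |·| is the Euclidean norm and ‖·‖ the operator norm. -/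
open MeasureTheory Filter Topology

noncomputable section

/-- The operator norm (with respect to Euclidean norms) of a matrix. -/
def opNorm {k : ℕ} (M : Matrix (Fin k) (Fin k) ℝ) : ℝ :=
  ‖LinearMap.toContinuousLinearMap (Matrix.toEuclideanLin M)‖

/-- The quadratic form of a matrix as a Euclidean inner product. -/
lemma inner_toEuclideanLin_self {n : ℕ} (G : Matrix (Fin n) (Fin n) ℝ)
    (x : EuclideanSpace ℝ (Fin n)) :
    inner ℝ x (Matrix.toEuclideanLin G x) = ∑ i, ∑ j, x i * G i j * x j := by
  simp only [PiLp.inner_apply, Matrix.toLpLin_apply, Matrix.mulVec, dotProduct,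
    RCLike.inner_apply, conj_trivial, Finset.sum_mul]
  exact Finset.sum_congr rfl fun i _ => Finset.sum_congr rfl fun j _ => by ring

lemma norm_toEuclideanLin_le {n : ℕ} (M : Matrix (Fin n) (Fin n) ℝ)
    (x : EuclideanSpace ℝ (Fin n)) :
    ‖Matrix.toEuclideanLin M x‖ ≤ opNorm M * ‖x‖ :=
  (LinearMap.toContinuousLinearMap (Matrix.toEuclideanLin M)).le_opNorm x

lemma inner_toEuclideanLin_le {n : ℕ} (M : Matrix (Fin n) (Fin n) ℝ)
    (x y : EuclideanSpace ℝ (Fin n)) :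
    inner ℝ x (Matrix.toEuclideanLin M y) ≤ ‖x‖ * (opNorm M * ‖y‖) :=
  (real_inner_le_norm _ _).trans
    (mul_le_mul_of_nonneg_left (norm_toEuclideanLin_le M y) (norm_nonneg x))

/-- The smallest eigenvalue bound `|x|² ≤ ‖G⁻¹‖ x' G x` for positive definite `G`. -/
lemma norm_sq_le_opNorm_inv_mul_inner {n : ℕ} {G : Matrix (Fin n) (Fin n) ℝ} (hG : G.PosDef)
    (x : EuclideanSpace ℝ (Fin n)) :
    ‖x‖ ^ 2 ≤ opNorm G⁻¹ * inner ℝ x (Matrix.toEuclideanLin G x) := by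
  have hAB : Matrix.toEuclideanLin G (Matrix.toEuclideanLin G⁻¹ x) = x := by
    simp [Matrix.toLpLin_apply, Matrix.mulVec_mulVec,
      Matrix.mul_nonsing_inv _ ((Matrix.isUnit_iff_isUnit_det _).mp hG.isUnit)]
  have hsymm := Matrix.isSymmetric_toEuclideanLin_iff.mpr hG.isHermitian
  set A := Matrix.toEuclideanLin G
  set y := Matrix.toEuclideanLin G⁻¹ x
  set b := opNorm G⁻¹
  have hb : 0 ≤ b := norm_nonneg _
  have hpos : ∀ v, 0 ≤ inner ℝ v (A v) := fun v => by
    have h := hG.posSemidef.dotProduct_mulVec_nonneg v.ofLp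
    simpa [A, inner_toEuclideanLin_self, Matrix.mulVec, dotProduct, Finset.mul_sum,
      mul_assoc] using h
  have hxy : inner ℝ x y ≤ ‖x‖ * (b * ‖x‖) := inner_toEuclideanLin_le _ x x
  have hyA : inner ℝ y (A x) = ‖x‖ ^ 2 := by
    rw [← hsymm y x, hAB, real_inner_self_eq_norm_sq]
  have hexp : inner ℝ (b • x - y) (A (b • x - y))
      = b ^ 2 * inner ℝ x (A x) - 2 * b * ‖x‖ ^ 2 + inner ℝ x y := by
    simp only [map_sub, map_smul, inner_sub_left, inner_sub_right, real_inner_smul_left,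
      real_inner_smul_right, hAB, hyA, real_inner_self_eq_norm_sq, real_inner_comm x y]
    ring
  have h := hpos (b • x - y)
  rw [hexp] at h
  rcases hb.eq_or_lt with hb0 | hb0
  · have hy0 : y = 0 := by
      have := norm_toEuclideanLin_le G⁻¹ x
      change ‖y‖ ≤ b * ‖x‖ at this
      rw [← hb0, zero_mul] at this
      exact norm_le_zero_iff.mp this
    rw [← hAB, hy0]
    simp
  · refine le_of_mul_le_mul_left ?_ hb0
    nlinarith

lemma rpow_sub_rpow_le {x y q : ℝ} (hx : 0 < x) (hy : 0 ≤ y) (hq0 : 0 < q) (hq1 : q ≤ 1) :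
    x ^ q - y ^ q ≤ x ^ (q - 1) * |x - y| := by
  rcases le_total x y with hxy | hxy
  · have h1 := Real.rpow_le_rpow hx.le hxy hq0.le
    have h2 : 0 ≤ x ^ (q - 1) * |x - y| := by positivity
    linarith
  · have h1 : y / x ≤ (y / x) ^ q := by
      simpa using Real.rpow_le_rpow_of_exponent_ge' (by positivity) (div_le_one_of_le₀ hxy hx.le)
        hq0.le hq1
    rw [Real.div_rpow hy hx.le, div_le_div_iff₀ hx (by positivity)] at h1
    rw [abs_of_nonneg (sub_nonneg.mpr hxy), Real.rpow_sub_one hx.ne', div_mul_eq_mul_div,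
      le_div_iff₀ hx]
    linarith

/-- Deterministic basic inequality for the penalized LSA objective, inequality (5.4). -/
theorem penalizedLSA_basic_inequality
    (p p0 : ℕ) (hp0 : 1 ≤ p0) (hp : p0 ≤ p)
    (q : ℝ) (hq0 : 0 < q) (hq1 : q ≤ 1)
    (G : Matrix (Fin p) (Fin p) ℝ) (hG : G.PosDef)
    (θtil θstar : EuclideanSpace ℝ (Fin p))
    (hactive : ∀ j : Fin p, (j : ℕ) < p0 → θstar j ≠ 0)
    (hzero : ∀ j : Fin p, p0 ≤ (j : ℕ) → θstar j = 0)
    (κ : Fin p → ℝ) (hκ : ∀ j, 0 ≤ κ j)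
    (Kstar : ℝ) (hK : Kstar = sSup ((fun j => |θstar j| ^ (q - 1)) '' {j : Fin p | (j : ℕ) < p0}))
    (a : ℝ) (ha : a = sSup (κ '' {j : Fin p | (j : ℕ) < p0}))
    (θhat : EuclideanSpace ℝ (Fin p))
    (hmin : Qobj G θtil κ q θhat ≤ Qobj G θtil κ q θstar) :
    ‖θhat - θstar‖ ≤ opNorm G⁻¹ * (2 * opNorm G * ‖θtil - θstar‖ + p0 * Kstar * a) := by
  have hmono : ∀ j : Fin p, (j : ℕ) < p0 → |θstar j| ^ (q - 1) ≤ Kstar ∧ κ j ≤ a := fun j hj => by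
    subst hK ha
    exact ⟨le_csSup (Set.toFinite _).bddAbove ⟨j, hj, rfl⟩,
      le_csSup (Set.toFinite _).bddAbove ⟨j, hj, rfl⟩⟩
  have hK0 : 0 ≤ Kstar :=
    (Real.rpow_nonneg (abs_nonneg _) _).trans (hmono ⟨0, by omega⟩ hp0).1
  have hpen : ∀ j : Fin p, κ j * |θstar j| ^ q - κ j * |θhat j| ^ q
      ≤ if (j : ℕ) < p0 then Kstar * a * ‖θhat - θstar‖ else 0 := fun j => by
    rw [← mul_sub]
    split_ifs with hj
    · obtain ⟨hKj, haj⟩ := hmono j hj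
      have hcoord : |(|θstar j| - |θhat j|)| ≤ ‖θhat - θstar‖ := by
        refine (abs_abs_sub_abs_le _ _).trans ?_
        rw [abs_sub_comm]
        exact PiLp.norm_apply_le (θhat - θstar) j
      calc κ j * (|θstar j| ^ q - |θhat j| ^ q)
          ≤ κ j * (|θstar j| ^ (q - 1) * |(|θstar j| - |θhat j|)|) :=
            mul_le_mul_of_nonneg_left (rpow_sub_rpow_le (abs_pos.mpr (hactive j hj))
              (abs_nonneg _) hq0 hq1) (hκ j)
        _ ≤ a * (Kstar * ‖θhat - θstar‖) :=
            mul_le_mul haj (mul_le_mul hKj hcoord (abs_nonneg _) hK0) (by positivity)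
              ((hκ j).trans haj)
        _ = Kstar * a * ‖θhat - θstar‖ := by ring
    · rw [hzero j (not_lt.mp hj), abs_zero, Real.zero_rpow hq0.ne', zero_sub]
      exact mul_nonpos_of_nonneg_of_nonpos (hκ j)
        (neg_nonpos.mpr (Real.rpow_nonneg (abs_nonneg _) _))
  have hcard : (Finset.univ.filter fun j : Fin p => (j : ℕ) < p0).card = p0 := by
    simp [Fin.card_filter_val_lt, hp]
  have hsum : ∑ j, κ j * |θstar j| ^ q - ∑ j, κ j * |θhat j| ^ q
      ≤ p0 * Kstar * a * ‖θhat - θstar‖ := by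
    rw [← Finset.sum_sub_distrib]
    refine (Finset.sum_le_sum fun j _ => hpen j).trans_eq ?_
    rw [← Finset.sum_filter, Finset.sum_const, hcard, nsmul_eq_mul]
    ring
  have hquad : ∀ θ : EuclideanSpace ℝ (Fin p), Qobj G θtil κ q θ
      = inner ℝ (θ - θtil) (Matrix.toEuclideanLin G (θ - θtil)) + ∑ j, κ j * |θ j| ^ q :=
    fun θ => by rw [inner_toEuclideanLin_self]; rfl
  rw [hquad, hquad] at hmin
  set u := θhat - θstar with hu
  set d := θtil - θstar with hd
  rw [show θhat - θtil = u - d by rw [hu, hd]; abel,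
    show θstar - θtil = -d by rw [hd]; abel] at hmin
  have hsymm := Matrix.isSymmetric_toEuclideanLin_iff.mpr hG.isHermitian
  have hdu : inner ℝ d (Matrix.toEuclideanLin G u) = inner ℝ u (Matrix.toEuclideanLin G d) := by
    rw [← hsymm d u, real_inner_comm]
  simp only [map_sub, map_neg, inner_sub_left, inner_sub_right, inner_neg_neg, hdu] at hmin
  have hcross := inner_toEuclideanLin_le G u d
  have hform : inner ℝ u (Matrix.toEuclideanLin G u)
      ≤ (2 * opNorm G * ‖d‖ + p0 * Kstar * a) * ‖u‖ := by linarith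
  have hmain := (norm_sq_le_opNorm_inv_mul_inner hG u).trans
    (mul_le_mul_of_nonneg_left hform (norm_nonneg _))
  rcases (norm_nonneg u).eq_or_lt with hu0 | hu0
  · have ha0 : 0 ≤ a := (hκ _).trans (hmono ⟨0, by omega⟩ hp0).2
    have hG0 : 0 ≤ opNorm G := norm_nonneg _
    have hGinv0 : 0 ≤ opNorm G⁻¹ := norm_nonneg _
    rw [← hu0]
    positivity
  · refine le_of_mul_le_mul_right ?_ hu0
    linarith
end
end

section
/- (Lemma 7.2: positivity of the identifiability index χ₀ for the Cox model.) Let d, J ∈ ℕ, let X be an ℝ^J-valued random vector on a probability space with E[exp(⟨u, X⟩)] < ∞ for every u ∈ ℝ^J. For θ = (θ^1,…,θ^d) ∈ (ℝ^J)^d define 𝕐(θ) = Σ_{α=1}^d E[ exp(⟨θ*^α, X⟩) ⟨θ^α − θ*^α, X⟩ − ( exp(⟨θ^α, X⟩) − exp(⟨θ*^α, X⟩) ) ], and for each α define the J×J matrix Γ_α(θ) = E[ X X′ exp(⟨θ^α, X⟩) ]. Let Θ ⊂ (ℝ^J)^d be a nonempty bounded open convex set containing the true value θ* = (θ*^1,…,θ*^d),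 and assume inf over θ in the closure of Θ of det( diag(Γ_1(θ),…,Γ_d(θ)) ) > 0. Then χ₀ := inf { −𝕐(θ) / |θ − θ*|² : θ in the closure of Θ, θ ≠ θ* } > 0. -/
open MeasureTheory Filter Topology

noncomputable section

theorem sq_mul_exp_neg_abs_le (h : ℝ) :
    h ^ 2 / 4 * Real.exp (-|h|) ≤ Real.exp h - 1 - h := by
  have h1 : Real.exp h = Real.exp (h / 2) ^ 2 := by
    rw [← Real.exp_nat_mul]; congr 1; push_cast; ring
  have h2 : Real.exp (-|h|) = Real.exp (-|h| / 2) ^ 2 := by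
    rw [← Real.exp_nat_mul]; congr 1; push_cast; ring
  have h3 := Real.add_one_le_exp (h / 2)
  suffices hs : (h / 2 * Real.exp (-|h| / 2)) ^ 2 ≤ (Real.exp (h / 2) - 1) ^ 2 by
    rw [h1, h2]; nlinarith
  apply sq_le_sq.2
  rw [abs_mul, Real.abs_exp]
  rcases le_total 0 h with hh | hh
  · rw [abs_of_nonneg hh, abs_of_nonneg (by linarith : (0 : ℝ) ≤ h / 2)]
    have h4 : Real.exp (-h / 2) ≤ 1 := Real.exp_le_one_iff.2 (by linarith)
    have h5 := le_abs_self (Real.exp (h / 2) - 1)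
    nlinarith
  · rw [abs_of_nonpos hh, neg_neg, abs_of_nonpos (by linarith : h / 2 ≤ 0)]
    have h4 := Real.add_one_le_exp (-(h / 2))
    have h5 := neg_abs_le (Real.exp (h / 2) - 1)
    have h6 : Real.exp (-(h / 2)) * Real.exp (h / 2) = 1 := by
      rw [← Real.exp_add]; simp
    nlinarith [Real.exp_pos (h / 2)]

theorem abs_mul_le_sum_exp (x y : ℝ) :
    |x * y| ≤ Real.exp x + Real.exp (-x) + (Real.exp y + Real.exp (-y)) := by
  have key : ∀ t : ℝ, t ^ 2 / 2 ≤ Real.exp t + Real.exp (-t) := by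
    intro t
    rcases le_total 0 t with ht | ht
    · linarith [Real.quadratic_le_exp_of_nonneg ht, Real.exp_pos (-t)]
    · have := Real.quadratic_le_exp_of_nonneg (neg_nonneg.2 ht)
      nlinarith [Real.exp_pos t]
  have hx := key x
  have hy := key y
  rw [abs_le]
  constructor <;> nlinarith [sq_nonneg (x + y), sq_nonneg (x - y)]

theorem abs_le_exp_add_exp_neg (x : ℝ) : |x| ≤ Real.exp x + Real.exp (-x) := by
  have h1 := Real.add_one_le_exp x
  have h2 := Real.add_one_le_exp (-x)
  rw [abs_le]
  constructor <;> linarith [Real.exp_pos x, Real.exp_pos (-x)]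

section ExponentialMoments

variable {Ω : Type*} [MeasurableSpace Ω] {P : Measure Ω} {ι : Type*} [Fintype ι]
  {X : Ω → ι → ℝ}

theorem integrable_exp_mul_exp
    (hexp : ∀ u : ι → ℝ, Integrable (fun ω => Real.exp (∑ j, u j * X ω j)) P) (u v : ι → ℝ) :
    Integrable (fun ω => Real.exp (∑ j, v j * X ω j) * Real.exp (∑ j, u j * X ω j)) P := by
  refine (hexp (v + u)).congr (.of_forall fun ω => ?_)
  simp only [← Real.exp_add, ← Finset.sum_add_distrib, Pi.add_apply, add_mul]

theorem integrable_exp_neg_mul_exp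
    (hexp : ∀ u : ι → ℝ, Integrable (fun ω => Real.exp (∑ j, u j * X ω j)) P) (u v : ι → ℝ) :
    Integrable (fun ω => Real.exp (-∑ j, v j * X ω j) * Real.exp (∑ j, u j * X ω j)) P := by
  simpa using integrable_exp_mul_exp hexp u (-v)

theorem integrable_linear_mul_exp (hX : ∀ i, Measurable fun ω => X ω i)
    (hexp : ∀ u : ι → ℝ, Integrable (fun ω => Real.exp (∑ j, u j * X ω j)) P) (u v : ι → ℝ) :
    Integrable (fun ω => Real.exp (∑ j, u j * X ω j) * ∑ j, v j * X ω j) P := by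
  refine ((integrable_exp_mul_exp hexp u v).add (integrable_exp_neg_mul_exp hexp u v)).mono'
    (by fun_prop) (.of_forall fun ω => ?_)
  have := abs_le_exp_add_exp_neg (∑ j, v j * X ω j)
  rw [Real.norm_eq_abs, abs_mul, Real.abs_exp, Pi.add_apply, ← add_mul, mul_comm]
  gcongr

theorem integrable_mul_mul_exp (hX : ∀ i, Measurable fun ω => X ω i)
    (hexp : ∀ u : ι → ℝ, Integrable (fun ω => Real.exp (∑ j, u j * X ω j)) P) (u : ι → ℝ)
    (i j : ι) :
    Integrable (fun ω => X ω i * X ω j * Real.exp (∑ k, u k * X ω k)) P := by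
  classical
  have hp := fun k => integrable_exp_mul_exp hexp u (Pi.single k 1)
  have hn := fun k => integrable_exp_neg_mul_exp hexp u (Pi.single k 1)
  refine (((hp i).add (hn i)).add ((hp j).add (hn j))).mono'
    (by fun_prop) (.of_forall fun ω => ?_)
  have := abs_mul_le_sum_exp (X ω i) (X ω j)
  rw [Real.norm_eq_abs, abs_mul, Real.abs_exp]
  simp only [Pi.add_apply, ← add_mul, Pi.single_apply, ite_mul, one_mul, zero_mul,
    Finset.sum_ite_eq', Finset.mem_univ, if_true]
  gcongr

theorem integrable_mul_mul_damped_exp (hX : ∀ i, Measurable fun ω => X ω i)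
    (hexp : ∀ u : ι → ℝ, Integrable (fun ω => Real.exp (∑ j, u j * X ω j)) P) (u : ι → ℝ)
    {R : ℝ} (hR : 0 ≤ R) (i j : ι) :
    Integrable (fun ω => X ω i * X ω j *
      (Real.exp (-(R * ∑ k, |X ω k|)) * Real.exp (∑ k, u k * X ω k))) P := by
  refine (integrable_mul_mul_exp hX hexp u i j).norm.mono' (by fun_prop)
    (.of_forall fun ω => ?_)
  have h1 : Real.exp (-(R * ∑ k, |X ω k|)) ≤ 1 :=
    Real.exp_le_one_iff.2 (neg_nonpos.2 (by positivity))
  rw [norm_mul, norm_mul (_ * _) (Real.exp _)]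
  gcongr
  rw [Real.norm_eq_abs, Real.norm_eq_abs, abs_mul, Real.abs_exp, Real.abs_exp]
  exact mul_le_of_le_one_left (Real.exp_pos _).le h1

theorem sq_sum_mul_eq (v x : ι → ℝ) (w : ℝ) :
    (∑ j, v j * x j) ^ 2 * w = ∑ i, ∑ j, v i * v j * (x i * x j * w) := by
  rw [sq, Finset.sum_mul_sum, Finset.sum_mul]
  refine Finset.sum_congr rfl fun i _ => ?_
  rw [Finset.sum_mul]
  exact Finset.sum_congr rfl fun j _ => by ring

theorem integrable_sq_mul_damped_exp (hX : ∀ i, Measurable fun ω => X ω i)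
    (hexp : ∀ u : ι → ℝ, Integrable (fun ω => Real.exp (∑ j, u j * X ω j)) P) (u : ι → ℝ)
    {R : ℝ} (hR : 0 ≤ R) (v : ι → ℝ) :
    Integrable (fun ω => (∑ j, v j * X ω j) ^ 2 *
      (Real.exp (-(R * ∑ k, |X ω k|)) * Real.exp (∑ k, u k * X ω k))) P := by
  simp only [sq_sum_mul_eq]
  exact integrable_finsetSum _ fun i _ => integrable_finsetSum _ fun j _ =>
    (integrable_mul_mul_damped_exp hX hexp u hR i j).const_mul _

theorem integral_sq_mul_damped_exp (hX : ∀ i, Measurable fun ω => X ω i)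
    (hexp : ∀ u : ι → ℝ, Integrable (fun ω => Real.exp (∑ j, u j * X ω j)) P) (u : ι → ℝ)
    {R : ℝ} (hR : 0 ≤ R) (v : ι → ℝ) :
    ∫ ω, (∑ j, v j * X ω j) ^ 2 *
      (Real.exp (-(R * ∑ k, |X ω k|)) * Real.exp (∑ k, u k * X ω k)) ∂P =
    ∑ i, ∑ j, v i * v j * ∫ ω, X ω i * X ω j *
      (Real.exp (-(R * ∑ k, |X ω k|)) * Real.exp (∑ k, u k * X ω k)) ∂P := by
  have hI := integrable_mul_mul_damped_exp hX hexp u hR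
  simp only [sq_sum_mul_eq]
  rw [integral_finsetSum _ fun i _ => integrable_finsetSum _ fun j _ => (hI i j).const_mul _]
  refine Finset.sum_congr rfl fun i _ => ?_
  rw [integral_finsetSum _ fun j _ => (hI i j).const_mul _]
  exact Finset.sum_congr rfl fun j _ => integral_const_mul _ _

theorem integral_sq_mul_damped_exp_pos (hX : ∀ i, Measurable fun ω => X ω i)
    (hexp : ∀ u : ι → ℝ, Integrable (fun ω => Real.exp (∑ j, u j * X ω j)) P) (u : ι → ℝ)
    {R : ℝ} (hR : 0 ≤ R) [DecidableEq ι] {Γ : Matrix ι ι ℝ}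
    (hΓ : ∀ i j, Γ i j = ∫ ω, X ω i * X ω j * Real.exp (∑ k, u k * X ω k) ∂P)
    (hdet : Γ.det ≠ 0) {v : ι → ℝ} (hv : v ≠ 0) :
    0 < ∫ ω, (∑ j, v j * X ω j) ^ 2 *
      (Real.exp (-(R * ∑ k, |X ω k|)) * Real.exp (∑ k, u k * X ω k)) ∂P := by
  have hnonneg : ∀ ω, 0 ≤ (∑ j, v j * X ω j) ^ 2 *
      (Real.exp (-(R * ∑ k, |X ω k|)) * Real.exp (∑ k, u k * X ω k)) := fun ω => by positivity
  refine lt_of_le_of_ne (integral_nonneg hnonneg) fun h0 => hv ?_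
  have hae := (integral_eq_zero_iff_of_nonneg hnonneg
    (integrable_sq_mul_damped_exp hX hexp u hR v)).1 h0.symm
  refine Matrix.eq_zero_of_mulVec_eq_zero hdet (funext fun i => ?_)
  have h1 : (Γ.mulVec v) i =
      ∫ ω, ∑ j, X ω i * X ω j * Real.exp (∑ k, u k * X ω k) * v j ∂P := by
    rw [integral_finsetSum _ fun j _ => (integrable_mul_mul_exp hX hexp u i j).mul_const _]
    simp only [Matrix.mulVec, dotProduct, hΓ, integral_mul_const]
  rw [h1, Pi.zero_apply]
  refine integral_eq_zero_of_ae ?_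
  filter_upwards [hae] with ω hω
  have h2 : ∑ j, v j * X ω j = 0 := by
    simpa [Real.exp_ne_zero] using hω
  calc ∑ j, X ω i * X ω j * Real.exp (∑ k, u k * X ω k) * v j
      = X ω i * Real.exp (∑ k, u k * X ω k) * ∑ j, v j * X ω j := by
        rw [Finset.mul_sum]; exact Finset.sum_congr rfl fun j _ => by ring
    _ = 0 := by rw [h2, mul_zero]

theorem integral_sq_mul_damped_exp_le (hX : ∀ i, Measurable fun ω => X ω i)
    (hexp : ∀ u : ι → ℝ, Integrable (fun ω => Real.exp (∑ j, u j * X ω j)) P) (u t : ι → ℝ)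
    {R : ℝ} (hR : 0 ≤ R) (ht : ∀ j, |t j - u j| ≤ R) :
    (∫ ω, (∑ j, (t j - u j) * X ω j) ^ 2 *
      (Real.exp (-(R * ∑ k, |X ω k|)) * Real.exp (∑ k, u k * X ω k)) ∂P) / 4 ≤
    -∫ ω, (Real.exp (∑ j, u j * X ω j) * (∑ j, (t j - u j) * X ω j) -
        (Real.exp (∑ j, t j * X ω j) - Real.exp (∑ j, u j * X ω j))) ∂P := by
  rw [← integral_div, ← integral_neg]
  refine integral_mono ((integrable_sq_mul_damped_exp hX hexp u hR fun j => t j - u j).div_const 4)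
    ((integrable_linear_mul_exp hX hexp u fun j => t j - u j).sub
      ((hexp t).sub (hexp u))).neg fun ω => ?_
  have hsum : ∑ j, t j * X ω j = ∑ j, (t j - u j) * X ω j + ∑ j, u j * X ω j := by
    rw [← Finset.sum_add_distrib]; exact Finset.sum_congr rfl fun j _ => by ring
  have habs : |∑ j, (t j - u j) * X ω j| ≤ R * ∑ k, |X ω k| := by
    rw [Finset.mul_sum]
    refine (Finset.abs_sum_le_sum_abs _ _).trans (Finset.sum_le_sum fun j _ => ?_)
    rw [abs_mul]
    exact mul_le_mul_of_nonneg_right (ht j) (abs_nonneg _)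
  dsimp only
  rw [hsum, Real.exp_add]
  set h := ∑ j, (t j - u j) * X ω j
  have hq := sq_mul_exp_neg_abs_le h
  have he : Real.exp (-(R * ∑ k, |X ω k|)) ≤ Real.exp (-|h|) :=
    Real.exp_le_exp.2 (neg_le_neg habs)
  have hle : h ^ 2 / 4 * Real.exp (-(R * ∑ k, |X ω k|)) ≤ Real.exp h - 1 - h :=
    (mul_le_mul_of_nonneg_left he (by positivity)).trans hq
  have := mul_le_mul_of_nonneg_right hle (Real.exp_pos (∑ k, u k * X ω k)).le
  linarith

end ExponentialMoments

/-- A function which is continuous, positive away from the origin and homogeneous of degree two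
dominates a positive multiple of the squared norm. -/
theorem exists_pos_mul_norm_sq_le {E : Type*} [NormedAddCommGroup E] [NormedSpace ℝ E]
    [FiniteDimensional ℝ E] [Nontrivial E] {q : E → ℝ} (hq : Continuous q)
    (hpos : ∀ v, v ≠ 0 → 0 < q v) (hsmul : ∀ (c : ℝ) v, q (c • v) = c ^ 2 * q v) :
    ∃ c > 0, ∀ v, c * ‖v‖ ^ 2 ≤ q v := by
  obtain ⟨v₀, hv₀, hmin⟩ := (isCompact_sphere (0 : E) 1).exists_isMinOn
    (NormedSpace.sphere_nonempty.2 zero_le_one) hq.continuousOn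
  refine ⟨q v₀, hpos _ (ne_zero_of_mem_unit_sphere ⟨v₀, hv₀⟩), fun v => ?_⟩
  rcases eq_or_ne v 0 with rfl | hv
  · have := hsmul 0 (0 : E)
    simp_all
  · have hn : ‖v‖ ≠ 0 := norm_ne_zero_iff.2 hv
    have hmem : ‖v‖⁻¹ • v ∈ Metric.sphere (0 : E) 1 := by
      simp [norm_smul, hn]
    have := hmin hmem
    simp only [Set.mem_ofPred_eq, hsmul] at this
    calc q v₀ * ‖v‖ ^ 2 ≤ (‖v‖⁻¹ ^ 2 * q v) * ‖v‖ ^ 2 := by gcongr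
      _ = q v := by field_simp

/-- Lemma 7.2: positivity of the identifiability index `χ₀` for the Cox model. -/
theorem cox_identifiability_index_positive
    {Ω : Type*} [MeasurableSpace Ω] (P : Measure Ω) [IsProbabilityMeasure P]
    (d J : ℕ) (hd : 1 ≤ d) (hJ : 1 ≤ J)
    (X : Ω → EuclideanSpace ℝ (Fin J)) (hX : Measurable X)
    -- exponential moments: `E[exp ⟨u, X⟩] < ∞` for every `u`
    (hexp : ∀ u : EuclideanSpace ℝ (Fin J),
      Integrable (fun ω => Real.exp (∑ j, u j * X ω j)) P)
    (Θ : Set (EuclideanSpace ℝ (Fin d × Fin J))) (hne : Θ.Nonempty)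
    (hbdd : Bornology.IsBounded Θ) (hopen : IsOpen Θ) (hconv : Convex ℝ Θ)
    (θstar : EuclideanSpace ℝ (Fin d × Fin J)) (hθstar : θstar ∈ Θ)
    -- the limit quasi-entropy `𝕐`
    (Y : EuclideanSpace ℝ (Fin d × Fin J) → ℝ)
    (hY : Y = fun θ => ∑ α : Fin d, ∫ ω,
      (Real.exp (∑ j, θstar (α, j) * X ω j) * (∑ j, (θ (α, j) - θstar (α, j)) * X ω j) -
        (Real.exp (∑ j, θ (α, j) * X ω j) - Real.exp (∑ j, θstar (α, j) * X ω j))) ∂P)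
    -- the matrices `Γ_α(θ) = E[X X' exp ⟨θ^α, X⟩]`
    (Γmat : Fin d → EuclideanSpace ℝ (Fin d × Fin J) → Matrix (Fin J) (Fin J) ℝ)
    (hΓ : ∀ α θ i j, Γmat α θ i j = ∫ ω, X ω i * X ω j * Real.exp (∑ k, θ (α, k) * X ω k) ∂P)
    -- non-degeneracy: `inf_{θ ∈ closure Θ} det (diag (Γ_1(θ), …, Γ_d(θ))) > 0`
    (hdet : 0 < sInf {x : ℝ |
      ∃ θ ∈ closure Θ, x = (Matrix.blockDiagonal fun α => Γmat α θ).det}) :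
    0 < sInf {x : ℝ | ∃ θ ∈ closure Θ, θ ≠ θstar ∧ x = -Y θ / ‖θ - θstar‖ ^ 2} := by
  set x : Ω → Fin J → ℝ := fun ω j => X ω j with hx
  have hxm : ∀ i, Measurable fun ω => x ω i := fun i => by
    simp only [hx]; fun_prop
  have hexp' : ∀ u : Fin J → ℝ, Integrable (fun ω => Real.exp (∑ j, u j * x ω j)) P :=
    fun u => hexp (WithLp.toLp 2 u)
  have hdetstar : ∀ α, (Γmat α θstar).det ≠ 0 := by
    have hb : BddBelow {x : ℝ |
        ∃ θ ∈ closure Θ, x = (Matrix.blockDiagonal fun α => Γmat α θ).det} := by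
      by_contra hb
      rw [Real.sInf_of_not_bddBelow hb] at hdet
      exact lt_irrefl _ hdet
    have h1 := hdet.trans_le (csInf_le hb ⟨θstar, subset_closure hθstar, rfl⟩)
    rw [Matrix.det_blockDiagonal] at h1
    exact fun α => Finset.prod_ne_zero_iff.1 h1.ne' α (Finset.mem_univ α)
  obtain ⟨R, hR0, hR⟩ : ∃ R : ℝ, 0 ≤ R ∧ ∀ θ ∈ closure Θ, ‖θ - θstar‖ ≤ R := by
    obtain ⟨R, hR⟩ := hbdd.closure.subset_closedBall θstar
    have hmem : ∀ θ ∈ closure Θ, ‖θ - θstar‖ ≤ R := fun θ hθ => by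
      simpa [dist_eq_norm] using hR hθ
    exact ⟨R, (norm_nonneg _).trans (hmem θstar (subset_closure hθstar)), hmem⟩
  let q : EuclideanSpace ℝ (Fin d × Fin J) → ℝ := fun v => ∑ α, ∫ ω,
    (∑ j, v (α, j) * x ω j) ^ 2 *
      (Real.exp (-(R * ∑ k, |x ω k|)) * Real.exp (∑ k, θstar (α, k) * x ω k)) ∂P
  have : Nonempty (Fin d × Fin J) := ⟨(⟨0, hd⟩, ⟨0, hJ⟩)⟩
  obtain ⟨c, hc, hcq⟩ : ∃ c > 0, ∀ v, c * ‖v‖ ^ 2 ≤ q v := by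
    refine exists_pos_mul_norm_sq_le ?_ (fun v hv => ?_) (fun c v => ?_)
    · have : q = fun v => ∑ α, ∑ i, ∑ j, v (α, i) * v (α, j) * ∫ ω, x ω i * x ω j *
          (Real.exp (-(R * ∑ k, |x ω k|)) * Real.exp (∑ k, θstar (α, k) * x ω k)) ∂P :=
        funext fun v => Finset.sum_congr rfl fun α _ =>
          integral_sq_mul_damped_exp hxm hexp' (fun k => θstar (α, k)) hR0 fun k => v (α, k)
      rw [this]
      fun_prop
    · obtain ⟨⟨α, j⟩, hαj⟩ : ∃ p, v p ≠ 0 := by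
        by_contra! h
        exact hv (PiLp.ext h)
      refine Finset.sum_pos' (fun β _ => integral_nonneg fun ω => by positivity)
        ⟨α, Finset.mem_univ α, ?_⟩
      exact integral_sq_mul_damped_exp_pos hxm hexp' (fun k => θstar (α, k)) hR0
        (hΓ α θstar) (hdetstar α) (v := fun k => v (α, k)) fun h => hαj (congrFun h j)
    · simp only [q, Finset.mul_sum (s := (Finset.univ : Finset (Fin d))), ← integral_const_mul]
      refine Finset.sum_congr rfl fun α _ => integral_congr_ae (.of_forall fun ω => ?_)
      simp only [PiLp.smul_apply, smul_eq_mul, mul_assoc c, ← Finset.mul_sum]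
      ring
  have hYle : ∀ θ ∈ closure Θ, q (θ - θstar) / 4 ≤ -Y θ := by
    intro θ hθ
    simp only [hY, q, Finset.sum_div, ← Finset.sum_neg_distrib]
    refine Finset.sum_le_sum fun α _ => ?_
    exact integral_sq_mul_damped_exp_le hxm hexp' (fun k => θstar (α, k)) (fun k => θ (α, k)) hR0
      fun j => (PiLp.norm_apply_le (θ - θstar) (α, j)).trans (hR θ hθ)
  obtain ⟨θ₁, hθ₁, hne₁⟩ : ∃ θ ∈ closure Θ, θ ≠ θstar := by
    have hnb : (𝓝[≠] θstar).NeBot := Module.punctured_nhds_neBot ℝ _ θstar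
    have hmem : Θ ∩ {θstar}ᶜ ∈ 𝓝[≠] θstar :=
      inter_mem (mem_nhdsWithin_of_mem_nhds (hopen.mem_nhds hθstar)) self_mem_nhdsWithin
    obtain ⟨θ, h1, h2⟩ := hnb.nonempty_of_mem hmem
    exact ⟨θ, subset_closure h1, h2⟩
  refine lt_of_lt_of_le (by positivity : 0 < c / 4) (le_csInf ⟨_, θ₁, hθ₁, hne₁, rfl⟩ ?_)
  rintro _ ⟨θ, hθ, hθne, rfl⟩
  have hn : 0 < ‖θ - θstar‖ := norm_pos_iff.2 (sub_ne_zero.2 hθne)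
  rw [le_div_iff₀ (by positivity)]
  linarith [hYle θ hθ, hcq (θ - θstar)]
end
end
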